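/- arXiv:1008.4523 — 2 statements merged into one kernel-verified Lean document; each statement's English description precedes it below -/
import Mathlib

section
/- Let C be a connected coalgebra over a field K (i.e., its coradical C₀ is one-dimensional, spanned by a group-like element), and let f : C → D be a coalgebra homomorphism whose restriction to the space P(C) of primitive elements of C is injective. Then f is injective. -/
open TensorProduct

/-- The image of `S ⊗ T` inside `C ⊗ C`, for submodules `S, T` of `C`. -/
noncomputable def subTensor {K C : Type*} [Field K] [AddCommGroup C] [Module K C]
    (S T : Submodule K C) : Submodule K (C ⊗[K] C) :=
  LinearMap.range (TensorProduct.map S.subtype T.subtype)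

/-- A subcoalgebra of a coalgebra `C`: a submodule `S` with `Δ(S) ⊆ S ⊗ S`. -/
def IsSubcoalgebra {K C : Type*} [Field K] [AddCommGroup C] [Module K C] [Coalgebra K C]
    (S : Submodule K C) : Prop :=
  ∀ s ∈ S, Coalgebra.comul (R := K) s ∈ subTensor S S

/-- A simple subcoalgebra: a nonzero subcoalgebra with no nonzero proper subcoalgebra. -/
def IsSimpleSubcoalgebra {K C : Type*} [Field K] [AddCommGroup C] [Module K C] [Coalgebra K C]
    (S : Submodule K C) : Prop :=
  IsSubcoalgebra S ∧ S ≠ ⊥ ∧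
    ∀ T : Submodule K C, T ≤ S → IsSubcoalgebra T → T = ⊥ ∨ T = S

/-- The coradical of a coalgebra: the sum of all its simple subcoalgebras. -/
noncomputable def coradical (K C : Type*) [Field K] [AddCommGroup C] [Module K C]
    [Coalgebra K C] : Submodule K C :=
  ⨆ S ∈ {S : Submodule K C | IsSimpleSubcoalgebra S}, S

open Coalgebra WithConv

universe u

/-- If every surjection from `A` onto a simple ring that kills `I` also kills `m`, and `A ⧸ I` is
Artinian, then some power of `m` lies in `I`. -/
theorem Ideal.exists_pow_le_of_forall_le_ker {A : Type u} [Ring A] (I m : Ideal A) [I.IsTwoSided]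
    [IsArtinianRing (A ⧸ I)]
    (h : ∀ (R : Type u) [Ring R] [IsSimpleRing R] (π : A →+* R), Function.Surjective π →
      I ≤ RingHom.ker π → m ≤ RingHom.ker π) : ∃ n, m ^ n ≤ I := by
  obtain ⟨k, D, d, hD, hd, ⟨e⟩⟩ := IsSemisimpleRing.exists_ringEquiv_pi_matrix_divisionRing
    ((A ⧸ I) ⧸ Ring.jacobson (A ⧸ I))
  let q : A →+* (A ⧸ I) ⧸ Ring.jacobson (A ⧸ I) :=
    (Ideal.Quotient.mk _).comp (Ideal.Quotient.mk I)
  have hq : Function.Surjective q :=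
    Ideal.Quotient.mk_surjective.comp Ideal.Quotient.mk_surjective
  have hm (a : A) (ha : a ∈ m) : Ideal.Quotient.mk I a ∈ Ring.jacobson (A ⧸ I) := by
    rw [← Ideal.Quotient.eq_zero_iff_mem]
    apply e.injective
    ext1 i
    have := hd i
    rw [map_zero]
    refine h _ ((Pi.evalRingHom _ i).comp (e.toRingHom.comp q)) ?_ ?_ ha
    · exact (Function.surjective_eval i).comp (e.surjective.comp hq)
    · intro b hb
      simp [q, Ideal.Quotient.eq_zero_iff_mem.mpr hb]
  obtain ⟨n, hn⟩ := IsSemiprimaryRing.isNilpotent (R := A ⧸ I)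
  have key (j : ℕ) (a : A) (ha : a ∈ m ^ j) :
      Ideal.Quotient.mk I a ∈ Ring.jacobson (A ⧸ I) ^ j := by
    induction j generalizing a with
    | zero => simp [Submodule.pow_zero]
    | succ j ih =>
      rw [Submodule.pow_succ] at ha ⊢
      refine Submodule.mul_induction_on ha (fun x hx y hy => ?_) (fun x y hx hy => ?_)
      · rw [map_mul]
        exact Ideal.mul_mem_mul (ih _ hx) (hm _ hy)
      · rw [map_add]
        exact add_mem hx hy
  refine ⟨n, fun a ha => Ideal.Quotient.eq_zero_iff_mem.mp ?_⟩
  simpa [hn] using key n a ha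

section Slices

variable {K V W : Type*} [Field K] [AddCommGroup V] [Module K V] [AddCommGroup W] [Module K W]

/-- Contraction of the right tensor factor with a functional. -/
noncomputable def TensorProduct.sliceRight (φ : W →ₗ[K] K) : V ⊗[K] W →ₗ[K] V :=
  (TensorProduct.rid K V).toLinearMap ∘ₗ φ.lTensor V

/-- Contraction of the left tensor factor with a functional. -/
noncomputable def TensorProduct.sliceLeft (φ : V →ₗ[K] K) : V ⊗[K] W →ₗ[K] W :=
  (TensorProduct.lid K W).toLinearMap ∘ₗ φ.rTensor W

@[simp]
theorem TensorProduct.sliceRight_tmul (φ : W →ₗ[K] K) (v : V) (w : W) :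
    sliceRight φ (v ⊗ₜ[K] w) = φ w • v := by
  simp [sliceRight]

@[simp]
theorem TensorProduct.sliceLeft_tmul (φ : V →ₗ[K] K) (v : V) (w : W) :
    sliceLeft φ (v ⊗ₜ[K] w) = φ v • w := by
  simp [sliceLeft]

theorem TensorProduct.eq_of_sliceRight_eq {s t : V ⊗[K] W}
    (h : ∀ φ : W →ₗ[K] K, sliceRight φ s = sliceRight φ t) : s = t := by
  classical
  let b := Module.Basis.ofVectorSpace K W
  apply (equivFinsuppOfBasisRight b).injective
  ext i
  simpa [equivFinsuppOfBasisRight_apply, sliceRight] using h (b.coord i)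

theorem TensorProduct.eq_of_sliceLeft_eq {s t : V ⊗[K] W}
    (h : ∀ φ : V →ₗ[K] K, sliceLeft φ s = sliceLeft φ t) : s = t := by
  classical
  let b := Module.Basis.ofVectorSpace K V
  apply (equivFinsuppOfBasisLeft b).injective
  ext i
  simpa [equivFinsuppOfBasisLeft_apply, sliceLeft] using h (b.coord i)

theorem TensorProduct.sliceRight_map {V' W' : Type*} [AddCommGroup V'] [Module K V']
    [AddCommGroup W'] [Module K W'] (p : V →ₗ[K] V') (q : W →ₗ[K] W') (φ : W' →ₗ[K] K)
    (t : V ⊗[K] W) : sliceRight φ (map p q t) = p (sliceRight (φ ∘ₗ q) t) := by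
  induction t <;> simp_all

theorem TensorProduct.sliceLeft_map {V' W' : Type*} [AddCommGroup V'] [Module K V']
    [AddCommGroup W'] [Module K W'] (p : V →ₗ[K] V') (q : W →ₗ[K] W') (φ : V' →ₗ[K] K)
    (t : V ⊗[K] W) : sliceLeft φ (map p q t) = q (sliceLeft (φ ∘ₗ p) t) := by
  induction t <;> simp_all

/-- If all slices of `t` lie in `S`, then `t` lies in `S ⊗ S`. -/
theorem mem_subTensor_of_slices {S : Submodule K V} {t : V ⊗[K] V}
    (hr : ∀ φ : V →ₗ[K] K, sliceRight φ t ∈ S) (hl : ∀ φ : V →ₗ[K] K, sliceLeft φ t ∈ S) :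
    t ∈ subTensor S S := by
  obtain ⟨p, hp⟩ := S.subtype.exists_leftInverse_of_injective S.ker_subtype
  have hpS (x : V) (hx : x ∈ S) : (p x : V) = x :=
    congr_arg Subtype.val (LinearMap.congr_fun hp ⟨x, hx⟩)
  have h₁ : map (S.subtype ∘ₗ p) LinearMap.id t = t :=
    eq_of_sliceRight_eq fun φ => by
      rw [sliceRight_map]
      exact hpS _ (hr φ)
  have h₂ : map LinearMap.id (S.subtype ∘ₗ p) t = t :=
    eq_of_sliceLeft_eq fun φ => by
      rw [sliceLeft_map]
      exact hpS _ (hl φ)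
  refine ⟨map p p t, ?_⟩
  rw [← LinearMap.comp_apply, ← TensorProduct.map_comp]
  nth_rw 2 [← h₁, ← h₂]
  rw [← LinearMap.comp_apply (map _ _), ← TensorProduct.map_comp]
  rfl

/-- A linear map injective on `U` is injective on tensors all of whose slices lie in `U`. -/
theorem eq_zero_of_map_eq_zero_of_slices {U : Submodule K V} {f : V →ₗ[K] W}
    (hf : ∀ u ∈ U, f u = 0 → u = 0) {t : V ⊗[K] V}
    (hr : ∀ φ : V →ₗ[K] K, sliceRight φ t ∈ U) (hl : ∀ φ : V →ₗ[K] K, sliceLeft φ t ∈ U)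
    (ht : map f f t = 0) : t = 0 := by
  have h₁ : map LinearMap.id f t = 0 := eq_of_sliceRight_eq fun φ => by
    rw [sliceRight_map, map_zero]
    refine hf _ (hr _) ?_
    rw [LinearMap.id_apply, ← sliceRight_map, ht, map_zero]
  refine eq_of_sliceLeft_eq fun φ => ?_
  rw [map_zero]
  refine hf _ (hl _) ?_
  rw [← LinearMap.comp_id φ, ← sliceLeft_map, h₁, map_zero]

/-- A space of functionals containing the annihilator of a finite-dimensional subspace is closed. -/
theorem Submodule.dualCoannihilator_dualAnnihilator_le_of_dualAnnihilator_le
    {M : Submodule K (Module.Dual K V)} (F : Submodule K V) [FiniteDimensional K F]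
    (h : F.dualAnnihilator ≤ M) : M.dualCoannihilator.dualAnnihilator ≤ M := by
  intro φ hφ
  have : F.subtype.dualMap φ ∈ M.map F.subtype.dualMap := by
    rw [← Subspace.dualCoannihilator_dualAnnihilator_eq (W := M.map F.subtype.dualMap),
      mem_dualAnnihilator]
    intro w hw
    rw [mem_dualCoannihilator] at hw
    refine (mem_dualAnnihilator φ).mp hφ w ((mem_dualCoannihilator _).mpr fun ψ hψ => ?_)
    exact hw _ (mem_map_of_mem hψ)
  obtain ⟨ψ, hψ, hψφ⟩ := this
  have hsub : φ - ψ ∈ M := h <| (mem_dualAnnihilator _).mpr fun w hw => by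
    have := LinearMap.congr_fun hψφ ⟨w, hw⟩
    simp only [LinearMap.dualMap_apply, subtype_apply] at this
    simp [this]
  simpa using add_mem hsub hψ

end Slices

section ConvolutionDual

variable {K C : Type*} [Field K] [AddCommGroup C] [Module K C] [Coalgebra K C]

theorem convMul_apply_eq_sliceRight (ψ φ : WithConv (C →ₗ[K] K)) (c : C) :
    (ψ * φ) c = ψ (sliceRight φ.ofConv (comul c)) := by
  rw [LinearMap.convMul_apply]
  induction (comul c : C ⊗[K] C) <;> simp_all [mul_comm]

theorem convMul_apply_eq_sliceLeft (ψ φ : WithConv (C →ₗ[K] K)) (c : C) :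
    (ψ * φ) c = φ (sliceLeft ψ.ofConv (comul c)) := by
  rw [LinearMap.convMul_apply]
  induction (comul c : C ⊗[K] C) <;> simp_all

theorem convMul_apply_eq_zero_of_mem_subcoalgebra {T : Submodule K C} (hT : IsSubcoalgebra T)
    {ψ φ : WithConv (C →ₗ[K] K)} (h : (∀ t ∈ T, ψ t = 0) ∨ ∀ t ∈ T, φ t = 0) {t : C}
    (ht : t ∈ T) : (ψ * φ) t = 0 := by
  obtain ⟨y, hy⟩ := hT t ht
  rw [LinearMap.convMul_apply, ← hy]
  clear hy
  induction y with
  | zero => simp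
  | tmul a b => rcases h with h | h <;> simp [h]
  | add a b ha hb => simp [ha, hb]

/-- The functionals killed by a ring homomorphism, as a `K`-subspace of the dual. -/
noncomputable def RingHom.dualKer {R : Type*} [Ring R] (π : WithConv (C →ₗ[K] K) →+* R) :
    Submodule K (Module.Dual K C) :=
  ((RingHom.ker π).restrictScalars K).comap (WithConv.linearEquiv K (C →ₗ[K] K)).symm.toLinearMap

theorem RingHom.mem_dualKer {R : Type*} [Ring R] {π : WithConv (C →ₗ[K] K) →+* R}
    {φ : Module.Dual K C} : φ ∈ π.dualKer ↔ π (toConv φ) = 0 := Iff.rfl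

/-- The annihilator of the kernel of a surjection onto a simple ring is a simple subcoalgebra,
provided that kernel is closed in the finite topology. -/
theorem isSimpleSubcoalgebra_dualCoannihilator_dualKer {R : Type*} [Ring R] [IsSimpleRing R]
    {π : WithConv (C →ₗ[K] K) →+* R} (hπ : Function.Surjective π)
    (hcl : π.dualKer.dualCoannihilator.dualAnnihilator ≤ π.dualKer) :
    IsSimpleSubcoalgebra π.dualKer.dualCoannihilator := by
  have hone : toConv (counit : C →ₗ[K] K) = 1 := rfl
  refine ⟨fun s hs => mem_subTensor_of_slices (fun φ => ?_) (fun φ => ?_), fun hbot => ?_,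
    fun T hTS hT => ?_⟩
  · refine (Submodule.mem_dualCoannihilator _).mpr fun ψ hψ => ?_
    rw [← convMul_apply_eq_sliceRight (toConv ψ) (toConv φ)]
    refine (Submodule.mem_dualCoannihilator _).mp hs (ofConv (toConv ψ * toConv φ)) ?_
    rw [RingHom.mem_dualKer] at hψ ⊢
    simp [hψ]
  · refine (Submodule.mem_dualCoannihilator _).mpr fun ψ hψ => ?_
    rw [← convMul_apply_eq_sliceLeft (toConv φ) (toConv ψ)]
    refine (Submodule.mem_dualCoannihilator _).mp hs (ofConv (toConv φ * toConv ψ)) ?_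
    rw [RingHom.mem_dualKer] at hψ ⊢
    simp [hψ]
  · have h1 : (counit : C →ₗ[K] K) ∈ π.dualKer := hcl (by simp [hbot])
    rw [RingHom.mem_dualKer, hone, map_one] at h1
    exact one_ne_zero h1
  · let J : TwoSidedIdeal R := TwoSidedIdeal.mk' {r | ∃ φ, (∀ t ∈ T, φ.ofConv t = 0) ∧ π φ = r}
      ⟨0, by simp, map_zero π⟩
      (by
        rintro _ _ ⟨φ, hφ, rfl⟩ ⟨ψ, hψ, rfl⟩
        exact ⟨φ + ψ, fun t ht => by simp [hφ t ht, hψ t ht], map_add π _ _⟩)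
      (by
        rintro _ ⟨φ, hφ, rfl⟩
        exact ⟨-φ, fun t ht => by simp [hφ t ht], map_neg π _⟩)
      (by
        rintro r _ ⟨φ, hφ, rfl⟩
        obtain ⟨α, rfl⟩ := hπ r
        exact ⟨α * φ, fun t ht => convMul_apply_eq_zero_of_mem_subcoalgebra hT (.inr hφ) ht,
          map_mul π _ _⟩)
      (by
        rintro _ r ⟨φ, hφ, rfl⟩
        obtain ⟨α, rfl⟩ := hπ r
        exact ⟨φ * α, fun t ht => convMul_apply_eq_zero_of_mem_subcoalgebra hT (.inl hφ) ht,
          map_mul π _ _⟩)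
    have hJ (r : R) : r ∈ J ↔ ∃ φ, (∀ t ∈ T, φ.ofConv t = 0) ∧ π φ = r :=
      TwoSidedIdeal.mem_mk' ..
    rcases eq_bot_or_eq_top J with h | h
    · right
      refine le_antisymm hTS ?_
      rw [← Subspace.dualAnnihilator_dualCoannihilator_eq (W := T)]
      refine Submodule.dualCoannihilator_anti fun φ hφ => ?_
      have : π (toConv φ) ∈ J := (hJ _).mpr ⟨_, (Submodule.mem_dualAnnihilator φ).mp hφ, rfl⟩
      rwa [h, TwoSidedIdeal.mem_bot] at this
    · left
      obtain ⟨φ, hφ, hφ1⟩ := (hJ 1).mp (h ▸ trivial)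
      have hε (t : C) (ht : t ∈ T) : counit (R := K) t = 0 := by
        have := (Submodule.mem_dualCoannihilator _).mp (hTS ht) (counit - φ.ofConv)
          (by rw [RingHom.mem_dualKer, toConv_sub, hone, map_sub]; simp [hφ1])
        simpa [hφ t ht] using this
      refine (Submodule.eq_bot_iff _).mpr fun t ht => ?_
      refine (Module.forall_dual_apply_eq_zero_iff K t).mp fun φ => ?_
      have := convMul_apply_eq_zero_of_mem_subcoalgebra hT (ψ := 1) (φ := toConv φ) (.inl hε) ht
      simpa only [one_mul] using this

/-- The largest two-sided ideal of the convolution dual contained in the annihilator of `x`. -/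
noncomputable def coefficientIdeal (K : Type*) {C : Type*} [Field K] [AddCommGroup C] [Module K C]
    [Coalgebra K C] (x : C) : Ideal (WithConv (C →ₗ[K] K)) where
  carrier := {φ | ∀ α β, (α * φ * β) x = 0}
  zero_mem' α β := by rw [mul_zero, zero_mul]; rfl
  add_mem' {φ ψ} hφ hψ α β := by
    rw [mul_add, add_mul, ofConv_add, LinearMap.add_apply, hφ, hψ, add_zero]
  smul_mem' c φ hφ α β := by
    rw [smul_eq_mul, ← mul_assoc]
    exact hφ _ _

instance (x : C) : (coefficientIdeal K x).IsTwoSided where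
  mul_mem_of_left c hφ α β := by
    rw [← mul_assoc, mul_assoc _ c]
    exact hφ _ _

theorem apply_eq_zero_of_mem_coefficientIdeal {x : C} {φ : WithConv (C →ₗ[K] K)}
    (hφ : φ ∈ coefficientIdeal K x) : φ x = 0 := by
  simpa only [one_mul, mul_one] using hφ 1 1

theorem exists_finiteDimensional_forall_mem_coefficientIdeal (K : Type*) {C : Type*} [Field K]
    [AddCommGroup C] [Module K C] [Coalgebra K C] (x : C) :
    ∃ F : Submodule K C, FiniteDimensional K F ∧
      ∀ φ ∈ F.dualAnnihilator, toConv φ ∈ coefficientIdeal K x := by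
  let r := Coalgebra.Repr.arbitrary K x
  let s (i) := Coalgebra.Repr.arbitrary K (r.left i)
  refine ⟨Submodule.span K (⋃ i ∈ r.index, (s i).right '' (s i).index),
    FiniteDimensional.span_of_finite K <|
      r.index.finite_toSet.biUnion fun i _ => (s i).index.finite_toSet.image _,
    fun φ hφ α β => ?_⟩
  rw [r.convMul_apply]
  refine Finset.sum_eq_zero fun i hi => ?_
  rw [(s i).convMul_apply, Finset.sum_eq_zero, zero_mul]
  intro j hj
  rw [(Submodule.mem_dualAnnihilator φ).mp hφ _ (Submodule.subset_span ?_), mul_zero]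
  exact Set.mem_biUnion hi ⟨j, hj, rfl⟩

instance (x : C) : Module.Finite K (WithConv (C →ₗ[K] K) ⧸ coefficientIdeal K x) := by
  obtain ⟨F, _, hF⟩ := exists_finiteDimensional_forall_mem_coefficientIdeal K x
  obtain ⟨σ, hσ⟩ := F.subtype.dualMap.exists_rightInverse_of_surjective
    (LinearMap.range_eq_top.mpr (LinearMap.dualMap_surjective_of_injective F.injective_subtype))
  refine Module.Finite.of_surjective ((Ideal.Quotient.mkₐ K (coefficientIdeal K x)).toLinearMap ∘ₗ
    (WithConv.linearEquiv K (C →ₗ[K] K)).symm.toLinearMap ∘ₗ σ) fun y => ?_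
  obtain ⟨φ, rfl⟩ := Ideal.Quotient.mk_surjective y
  refine ⟨F.subtype.dualMap φ.ofConv, Ideal.Quotient.eq.mpr ?_⟩
  refine hF (σ (F.subtype.dualMap φ.ofConv) - φ.ofConv) ?_
  refine (Submodule.mem_dualAnnihilator _).mpr fun w hw => ?_
  have := LinearMap.congr_fun (LinearMap.congr_fun hσ (F.subtype.dualMap φ.ofConv)) ⟨w, hw⟩
  simpa [sub_eq_zero] using this

/-- Evaluation at a group-like element is a character of the convolution dual. -/
noncomputable def IsGroupLikeElem.evalRingHom {g : C} (hg : IsGroupLikeElem K g) :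
    WithConv (C →ₗ[K] K) →+* K where
  toFun φ := φ g
  map_one' := by simp [hg.counit_eq_one]
  map_mul' φ ψ := by simp [hg.comul_eq_tmul_self]
  map_zero' := rfl
  map_add' _ _ := rfl

theorem IsGroupLikeElem.mem_ker_evalRingHom {g : C} (hg : IsGroupLikeElem K g)
    {φ : WithConv (C →ₗ[K] K)} : φ ∈ RingHom.ker hg.evalRingHom ↔ φ g = 0 := Iff.rfl

/-- In a connected coalgebra every element is killed by a power of the augmentation ideal. -/
theorem exists_forall_mem_pow_apply_eq_zero {g : C} (hg : IsGroupLikeElem K g)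
    (hconn : coradical K C ≤ Submodule.span K {g}) (x : C) :
    ∃ n, ∀ φ ∈ RingHom.ker hg.evalRingHom ^ n, φ x = 0 := by
  have : IsArtinianRing (WithConv (C →ₗ[K] K) ⧸ coefficientIdeal K x) :=
    IsArtinianRing.of_finite K _
  obtain ⟨n, hn⟩ := Ideal.exists_pow_le_of_forall_le_ker (coefficientIdeal K x)
    (RingHom.ker hg.evalRingHom) (by
      intro R _ _ π hπ hI φ hφ
      obtain ⟨F, _, hF⟩ := exists_finiteDimensional_forall_mem_coefficientIdeal K x
      have hcl := Submodule.dualCoannihilator_dualAnnihilator_le_of_dualAnnihilator_le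
        (M := π.dualKer) F fun ψ hψ => hI (hF ψ hψ)
      have hS : π.dualKer.dualCoannihilator ≤ Submodule.span K {g} :=
        (le_iSup₂_of_le (f := fun S (_ : S ∈ {S : Submodule K C | IsSimpleSubcoalgebra S}) => S) _
          (isSimpleSubcoalgebra_dualCoannihilator_dualKer hπ hcl) le_rfl).trans hconn
      refine hcl (x := φ.ofConv) ((Submodule.mem_dualAnnihilator _).mpr fun s hs => ?_)
      obtain ⟨a, rfl⟩ := Submodule.mem_span_singleton.mp (hS hs)
      rw [map_smul, hg.mem_ker_evalRingHom.mp hφ, smul_zero])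
  exact ⟨n, fun φ hφ => apply_eq_zero_of_mem_coefficientIdeal (hn hφ)⟩

/-- The elements killed by the `n`-th power of the augmentation ideal at `g`. -/
noncomputable def IsGroupLikeElem.filtration {g : C} (hg : IsGroupLikeElem K g) (n : ℕ) :
    Submodule K C where
  carrier := {c | ∀ φ ∈ RingHom.ker hg.evalRingHom ^ n, φ c = 0}
  zero_mem' φ _ := map_zero _
  add_mem' ha hb φ hφ := by rw [map_add, ha φ hφ, hb φ hφ, add_zero]
  smul_mem' a c hc φ hφ := by rw [map_smul, hc φ hφ, smul_zero]

theorem IsGroupLikeElem.eq_zero_of_mem_filtration_zero {g : C} (hg : IsGroupLikeElem K g) {c : C}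
    (hc : c ∈ hg.filtration 0) : c = 0 :=
  (Module.forall_dual_apply_eq_zero_iff K c).mp fun φ =>
    hc (toConv φ) (by simp [Submodule.pow_zero])

theorem IsGroupLikeElem.sub_counit_smul_mem_filtration {g : C} (hg : IsGroupLikeElem K g) {n : ℕ}
    {c : C} (hc : c ∈ hg.filtration n) : c - counit (R := K) c • g ∈ hg.filtration n := by
  cases n with
  | zero => simp [hg.eq_zero_of_mem_filtration_zero hc]
  | succ n =>
    refine sub_mem hc (Submodule.smul_mem _ _ fun φ hφ => ?_)
    rw [Submodule.pow_succ] at hφ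
    exact hg.mem_ker_evalRingHom.mp (Ideal.mul_le_right hφ)

/-- The reduced comultiplication lowers the filtration degree in the left factor. -/
theorem IsGroupLikeElem.sliceRight_mem_filtration {g : C} (hg : IsGroupLikeElem K g) {n : ℕ} {c : C}
    (hc : c ∈ hg.filtration (n + 1)) (hε : counit (R := K) c = 0) (φ : C →ₗ[K] K) :
    sliceRight φ (comul c - (c ⊗ₜ[K] g + g ⊗ₜ[K] c)) ∈ hg.filtration n := by
  let φ' : C →ₗ[K] K := φ - φ g • counit
  have hφ' : toConv φ' ∈ RingHom.ker hg.evalRingHom :=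
    hg.mem_ker_evalRingHom.mpr (by simp [φ', hg.counit_eq_one])
  have hv : sliceRight φ' (comul c) ∈ hg.filtration n := fun ψ hψ => by
    rw [← convMul_apply_eq_sliceRight ψ (toConv φ')]
    refine hc _ ?_
    rw [Submodule.pow_succ]
    exact Ideal.mul_mem_mul hψ hφ'
  have hεv : counit (R := K) (sliceRight φ' (comul c)) = φ c := by
    have := convMul_apply_eq_sliceRight 1 (toConv φ') c
    rw [one_mul] at this
    simpa [φ', hε] using this.symm
  have hφ'c : sliceRight φ' (comul c) = sliceRight φ (comul c) - φ g • c := by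
    simp [φ', sliceRight, LinearMap.lTensor_sub, LinearMap.lTensor_smul]
  have := hg.sub_counit_smul_mem_filtration hv
  rw [hεv, hφ'c] at this
  simpa [sub_sub] using this

/-- The reduced comultiplication lowers the filtration degree in the right factor. -/
theorem IsGroupLikeElem.sliceLeft_mem_filtration {g : C} (hg : IsGroupLikeElem K g) {n : ℕ} {c : C}
    (hc : c ∈ hg.filtration (n + 1)) (hε : counit (R := K) c = 0) (φ : C →ₗ[K] K) :
    sliceLeft φ (comul c - (c ⊗ₜ[K] g + g ⊗ₜ[K] c)) ∈ hg.filtration n := by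
  let φ' : C →ₗ[K] K := φ - φ g • counit
  have hφ' : toConv φ' ∈ RingHom.ker hg.evalRingHom :=
    hg.mem_ker_evalRingHom.mpr (by simp [φ', hg.counit_eq_one])
  have hv : sliceLeft φ' (comul c) ∈ hg.filtration n := fun ψ hψ => by
    rw [← convMul_apply_eq_sliceLeft (toConv φ') ψ]
    refine hc _ ?_
    rw [Ideal.IsTwoSided.pow_succ]
    exact Ideal.mul_mem_mul hφ' hψ
  have hεv : counit (R := K) (sliceLeft φ' (comul c)) = φ c := by
    have := convMul_apply_eq_sliceLeft (toConv φ') 1 c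
    rw [mul_one] at this
    simpa [φ', hε] using this.symm
  have hφ'c : sliceLeft φ' (comul c) = sliceLeft φ (comul c) - φ g • c := by
    simp [φ', sliceLeft, LinearMap.rTensor_sub, LinearMap.rTensor_smul]
  have := hg.sub_counit_smul_mem_filtration hv
  rw [hεv, hφ'c] at this
  simpa [sub_sub, add_comm] using this

end ConvolutionDual

/-- Heyneman–Radford type lemma: let `C` be a connected coalgebra (the
coradical is spanned by a group-like `g = 1_C`) and `f : C → D` a coalgebra homomorphism
injective on the primitive elements `P(C) = {c | Δ c = c ⊗ g + g ⊗ c}`.  Then `f` is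
injective. -/
theorem stmt6 {K C D : Type*} [Field K]
    [AddCommGroup C] [Module K C] [Coalgebra K C]
    [AddCommGroup D] [Module K D] [Coalgebra K D]
    (g : C) (hg_comul : Coalgebra.comul (R := K) g = g ⊗ₜ g)
    (hg_counit : Coalgebra.counit (R := K) g = 1)
    (hconn : coradical K C = Submodule.span K {g})
    (f : C →ₗc[K] D)
    (hinj : Set.InjOn f {c : C | Coalgebra.comul (R := K) c = c ⊗ₜ g + g ⊗ₜ c}) :
    Function.Injective f := by
  have hg : IsGroupLikeElem K g := ⟨hg_counit, hg_comul⟩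
  have key (n : ℕ) : ∀ c ∈ hg.filtration n, f.toLinearMap c = 0 → c = 0 := by
    induction n with
    | zero => exact fun c hc _ => hg.eq_zero_of_mem_filtration_zero hc
    | succ n ih =>
      intro c hc hfc
      have hfc' : f c = 0 := hfc
      have hε : Coalgebra.counit (R := K) c = 0 := by
        rw [← CoalgHomClass.counit_comp_apply f c, hfc', map_zero]
      have hprim : Coalgebra.comul (R := K) c = c ⊗ₜ g + g ⊗ₜ c := by
        refine sub_eq_zero.mp (eq_zero_of_map_eq_zero_of_slices ih
          (hg.sliceRight_mem_filtration hc hε) (hg.sliceLeft_mem_filtration hc hε) ?_)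
        simp [hfc']
      exact hinj hprim (by simp) (by rw [hfc', map_zero])
  refine (injective_iff_map_eq_zero f).mpr fun c hfc => ?_
  obtain ⟨n, hn⟩ := exists_forall_mem_pow_apply_eq_zero hg hconn.le c
  exact key n c hn hfc
end

section
/- Let K have characteristic p > 0 and V a K-vector space. The space of primitive elements of the restricted symmetric algebra 𝔰(V) = T(V)/(xy − yx, x^p : x, y ∈ V), with the Hopf algebra structure in which the elements of V are primitive, is exactly the image of V. -/
open TensorProduct

/-- The defining relations of the restricted symmetric algebra
`𝔰(V) = T(V)/(xy - yx, x^p)`. -/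
inductive RestrictedSymRel (K V : Type*) [Field K] [AddCommGroup V] [Module K V] (p : ℕ) :
    TensorAlgebra K V → TensorAlgebra K V → Prop
  | comm (x y : V) :
      RestrictedSymRel K V p (TensorAlgebra.ι K x * TensorAlgebra.ι K y)
        (TensorAlgebra.ι K y * TensorAlgebra.ι K x)
  | pow (x : V) : RestrictedSymRel K V p (TensorAlgebra.ι K x ^ p) 0

section CommutativeAlgebra

open MvPolynomial

variable {K A ι : Type*} [Field K] [CommRing A] [Algebra K A]

/-- A derivation taking the same values as `∂/∂Xᵢ` on the generators `c` is induced
by `∂/∂Xᵢ`. -/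
lemma Derivation.apply_aeval_eq_aeval_pderiv [DecidableEq ι] (D : Derivation K A A) (c : ι → A)
    (i : ι) (hD : ∀ j, D (c j) = Pi.single (M := fun _ => A) i 1 j) (P : MvPolynomial ι K) :
    D (aeval c P) = aeval c (pderiv i P) := by
  induction P using MvPolynomial.induction_on with
  | C a => simp
  | add P Q hP hQ => simp [hP, hQ]
  | mul_X P j hP =>
    have hX : aeval c (pderiv i (X j : MvPolynomial ι K)) =
        Pi.single (M := fun _ => A) i 1 j := by
      rw [pderiv_X]
      obtain rfl | h := eq_or_ne j i
      · simp
      · simp [h]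
    simp only [map_mul, map_add, aeval_X, Derivation.leibniz, hP, hD, hX, smul_eq_mul]

/-- If `D` acts as `∂/∂Xᵢ` on the generators `c` and `cᵢ ^ p = 0`, then `1 - (cᵢ D) ^ (p - 1)` is
the evaluation at `cᵢ = 0`. -/
lemma Derivation.aeval_sub_euler_pow [DecidableEq ι] (p : ℕ) [Fact p.Prime] [CharP K p]
    (D : Derivation K A A) (c : ι → A) (i : ι)
    (hD : ∀ j, D (c j) = Pi.single (M := fun _ => A) i 1 j) (hc : c i ^ p = 0)
    (P : MvPolynomial ι K) :
    aeval c P - ((LinearMap.mulLeft K (c i) ∘ₗ D.toLinearMap) ^ (p - 1)) (aeval c P) =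
      aeval (Function.update c i 0) P := by
  have hp : p.Prime := Fact.out
  have hp1 : p - 1 ≠ 0 := by have := hp.two_le; omega
  induction P using MvPolynomial.induction_on' with
  | add P Q hP hQ => rw [map_add, map_add, map_add, ← hP, ← hQ]; abel
  | monomial m r =>
    have heuler : (LinearMap.mulLeft K (c i) ∘ₗ D.toLinearMap) (aeval c (monomial m r)) =
        (m i : K) • aeval c (monomial m r) := by
      have h := congrArg (aeval c) (X_mul_pderiv_monomial (i := i) (m := m) (r := r))
      rw [map_mul, aeval_X, ← D.apply_aeval_eq_aeval_pderiv c i hD, map_nsmul] at h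
      rw [Nat.cast_smul_eq_nsmul]
      exact h
    have hpow : ∀ k : ℕ, ((LinearMap.mulLeft K (c i) ∘ₗ D.toLinearMap) ^ k)
        (aeval c (monomial m r)) = (m i : K) ^ k • aeval c (monomial m r) := by
      intro k
      induction k with
      | zero => simp
      | succ k ih => rw [pow_succ', Module.End.mul_apply, ih, _root_.map_smul, heuler, smul_smul, pow_succ]
    rw [hpow]
    by_cases hmi : m i = 0
    · rw [hmi, Nat.cast_zero, zero_pow hp1, zero_smul, sub_zero, aeval_monomial, aeval_monomial]
      congr 1
      refine Finsupp.prod_congr fun j hj => ?_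
      rw [Function.update_of_ne]
      rintro rfl
      exact Finsupp.mem_support_iff.1 hj hmi
    · have hmem : i ∈ m.support := Finsupp.mem_support_iff.2 hmi
      have hzero : aeval (Function.update c i 0) (monomial m r) = 0 := by
        rw [aeval_monomial, Finsupp.prod, Finset.prod_eq_zero hmem, mul_zero]
        rw [Function.update_self, zero_pow hmi]
      rw [hzero]
      by_cases hdvd : p ∣ m i
      · have : aeval c (monomial m r) = 0 := by
          rw [aeval_monomial, Finsupp.prod, Finset.prod_eq_zero hmem, mul_zero]
          obtain ⟨k, hk⟩ := hdvd
          rw [hk] at hmi ⊢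
          rw [pow_mul, hc, zero_pow (right_ne_zero_of_mul hmi)]
        rw [this, smul_zero, sub_zero]
      · have hne : (m i : ZMod p) ≠ 0 := by rwa [Ne, ZMod.natCast_eq_zero_iff]
        have h := congrArg (ZMod.castHom dvd_rfl K) (ZMod.pow_card_sub_one_eq_one hne)
        rw [map_pow, _root_.map_natCast, map_one] at h
        rw [h, one_smul, sub_self]

/-- An element killed by all partial derivatives of a truncated polynomial algebra is a
constant. -/
lemma exists_algebraMap_eq_of_forall_derivation_eq_zero [DecidableEq ι] (p : ℕ) [Fact p.Prime]
    [CharP K p] (b : ι → A) (hb : ∀ i, b i ^ p = 0) (D : ι → Derivation K A A)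
    (hD : ∀ i j, D i (b j) = Pi.single (M := fun _ => A) i 1 j) (P : MvPolynomial ι K)
    (hP : ∀ i, D i (aeval b P) = 0) : ∃ r : K, algebraMap K A r = aeval b P := by
  have hp : p.Prime := Fact.out
  have key : ∀ s : Finset ι, aeval b P = aeval (fun j => if j ∈ s then 0 else b j) P := by
    intro s
    induction s using Finset.induction_on with
    | empty => simp
    | insert i s hi ih =>
      have h := (D i).aeval_sub_euler_pow p (fun j => if j ∈ s then 0 else b j) i
        (fun j => by
          by_cases hj : j ∈ s
          · have : j ≠ i := by rintro rfl; exact hi hj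
            simp [hj, this]
          · simp [hj, hD])
        (by simp [hi, hb]) P
      obtain ⟨k, hk⟩ : ∃ k, p - 1 = k + 1 := ⟨p - 2, by have := hp.two_le; omega⟩
      rw [← ih, hk, pow_succ, Module.End.mul_apply] at h
      have h0 : (LinearMap.mulLeft K (if i ∈ s then 0 else b i) ∘ₗ (D i).toLinearMap)
          (aeval b P) = 0 := by
        simp [hP]
      rw [h0, map_zero, sub_zero] at h
      rw [h]
      congr 2
      ext j
      obtain rfl | hj := eq_or_ne j i
      · simp
      · simp [hj]
  refine ⟨constantCoeff P, ?_⟩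
  rw [key P.vars, ← aeval_zero (S₁ := A)]
  exact eval₂Hom_congr' rfl (fun i hi _ => by simp [hi]) rfl

open DualNumber in
/-- If the elements of `V` are primitive for `Δ`, an infinitesimal character `φ` with values `f`
on `V` yields a derivation with values `f` on `V` which takes scalar values on primitive
elements. -/
lemma exists_derivation_of_dualNumber_algHom {V : Type*} [AddCommGroup V] [Module K V]
    (g : V →ₗ[K] A) (hg : Algebra.adjoin K (Set.range g) = ⊤) (Δ : A →ₐ[K] A ⊗[K] A)
    (hΔ : ∀ v, Δ (g v) = g v ⊗ₜ 1 + 1 ⊗ₜ g v)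
    (f : V →ₗ[K] K) (φ : A →ₐ[K] K[ε]) (hφ : ∀ v, φ (g v) = f v • ε) :
    ∃ D : Derivation K A A, (∀ v, D (g v) = algebraMap K A (f v)) ∧
      ∀ z, Δ z = z ⊗ₜ 1 + 1 ⊗ₜ z → ∃ r : K, D z = algebraMap K A r := by
  let e : K[ε] →ₐ[K] A[ε] :=
    DualNumber.lift ⟨(Algebra.ofId K A[ε], ε), by simp, fun _ => DualNumber.commute_eps_left _⟩
  have he : ∀ x, e x = TrivSqZeroExt.inl (algebraMap K A x.fst) +
      TrivSqZeroExt.inr (algebraMap K A x.snd) := by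
    intro x
    simp only [e, DualNumber.lift_apply_apply]
    ext <;> simp [Algebra.ofId_apply, Algebra.algebraMap_eq_smul_one]
  let inl : A →ₐ[K] A[ε] := TrivSqZeroExt.inlAlgHom K A A
  let ψ : A →ₐ[K] A[ε] :=
    (Algebra.TensorProduct.lift inl (e.comp φ) fun _ _ => Commute.all _ _).comp Δ
  have hprim : ∀ z, Δ z = z ⊗ₜ 1 + 1 ⊗ₜ z → ψ z = inl z + e (φ z) := by
    intro z hz
    simp [ψ, hz]
  have hψg : ∀ v, ψ (g v) = TrivSqZeroExt.inl (g v) + TrivSqZeroExt.inr (algebraMap K A (f v)) := by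
    intro v
    rw [hprim _ (hΔ v), hφ, he]
    simp [inl]
  have hfst : ∀ z, (ψ z).fst = z := by
    have : (TrivSqZeroExt.fstHom K A A).comp ψ = AlgHom.id K A := by
      refine AlgHom.ext_of_adjoin_eq_top hg ?_
      rintro _ ⟨v, rfl⟩
      simp [hψg]
    exact fun z => DFunLike.congr_fun this z
  refine ⟨Derivation.mk' ((TrivSqZeroExt.sndHom A A).restrictScalars K ∘ₗ ψ.toLinearMap) ?_,
    fun v => ?_, fun z hz => ⟨(φ z).snd, ?_⟩⟩
  · intro x y
    simp [hfst, mul_comm]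
  · simp [hψg, Algebra.algebraMap_eq_smul_one]
  · simp [hprim z hz, he, inl, Algebra.algebraMap_eq_smul_one]

/-- In a commutative algebra generated by primitive elements `g v` with `g v ^ p = 0`, and
admitting every linear form on `V` as an infinitesimal character, all primitive elements are in
the range of `g`. -/
lemma mem_range_of_primitive {V : Type*} [AddCommGroup V] [Module K V] (p : ℕ) [Fact p.Prime]
    [CharP K p] (g : V →ₗ[K] A) (hg : Algebra.adjoin K (Set.range g) = ⊤)
    (hpow : ∀ v, g v ^ p = 0) (hφ : ∀ f : V →ₗ[K] K, ∃ φ : A →ₐ[K] DualNumber K,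
      ∀ v, φ (g v) = f v • DualNumber.eps)
    (Δ : A →ₐ[K] A ⊗[K] A) (hΔ : ∀ v, Δ (g v) = g v ⊗ₜ 1 + 1 ⊗ₜ g v)
    (z : A) (hz : Δ z = z ⊗ₜ 1 + 1 ⊗ₜ z) : z ∈ LinearMap.range g := by
  classical
  let B := Module.Basis.ofVectorSpace K V
  choose φ hφ using fun i => hφ (B.coord i)
  choose D hDg hDprim using fun i =>
    exists_derivation_of_dualNumber_algHom g hg Δ hΔ (B.coord i) (φ i) (hφ i)
  have hD : ∀ i j, D i (g (B j)) = Pi.single (M := fun _ => A) i 1 j := by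
    intro i j
    rw [hDg, B.coord_apply, B.repr_self]
    obtain rfl | h := eq_or_ne j i
    · simp
    · simp [h]
  have hsurj : Function.Surjective (aeval (R := K) fun i => g (B i)) := by
    rw [← AlgHom.range_eq_top, eq_top_iff, ← hg, Algebra.adjoin_le_iff]
    rintro _ ⟨v, rfl⟩
    have hv : v ∈ Submodule.span K (Set.range B) := B.mem_span v
    induction hv using Submodule.span_induction with
    | mem x hx => obtain ⟨i, rfl⟩ := hx; exact ⟨X i, by simp⟩
    | zero => rw [map_zero]; exact zero_mem _
    | add x y _ _ hx hy => rw [map_add]; exact add_mem hx hy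
    | smul a x _ hx => rw [map_smul]; exact Subalgebra.smul_mem _ hx a
  choose r hr using fun i => hDprim i z hz
  obtain ⟨P, hP⟩ := hsurj z
  let u : V := ∑ i ∈ P.vars, r i • B i
  obtain ⟨Q, hQ⟩ := hsurj (z - g u)
  have hDw : ∀ i, D i (z - g u) = 0 := by
    intro i
    have hu : D i (g u) = if i ∈ P.vars then algebraMap K A (r i) else 0 := by
      simp only [u, map_sum, map_smul, Derivation.map_smul, hD]
      simp [Pi.single_apply, Algebra.algebraMap_eq_smul_one]
    rw [map_sub, hu]
    split_ifs with hi
    · rw [hr, sub_self]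
    · rw [← hP, (D i).apply_aeval_eq_aeval_pderiv _ i (hD i), pderiv_eq_zero_of_notMem_vars hi,
        map_zero, sub_zero]
  obtain ⟨a, ha⟩ := exists_algebraMap_eq_of_forall_derivation_eq_zero p (fun i => g (B i))
    (fun i => hpow _) D hD Q (by rwa [hQ])
  rw [hQ] at ha
  have hw : Δ (z - g u) = (z - g u) ⊗ₜ 1 + 1 ⊗ₜ (z - g u) := by
    rw [map_sub, hz, hΔ, sub_tmul, tmul_sub]
    abel
  have h := congrArg (Algebra.TensorProduct.lmul' (S := A) K) hw
  rw [← ha, AlgHom.commutes, AlgHom.commutes, map_add] at h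
  simp only [Algebra.TensorProduct.lmul'_apply_tmul, mul_one, one_mul] at h
  rw [left_eq_add, ha] at h
  exact ⟨u, (sub_eq_zero.1 h).symm⟩

end CommutativeAlgebra

namespace RestrictedSymRel

variable (K V : Type*) [Field K] [AddCommGroup V] [Module K V] (p : ℕ)

/-- The inclusion of `V` in its restricted symmetric algebra. -/
noncomputable abbrev incl : V →ₗ[K] RingQuot (RestrictedSymRel K V p) :=
  (RingQuot.mkAlgHom K (RestrictedSymRel K V p)).toLinearMap ∘ₗ TensorAlgebra.ι K (M := V)

lemma adjoin_range_incl : Algebra.adjoin K (Set.range (incl K V p)) = ⊤ := by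
  have : Set.range (incl K V p) =
      RingQuot.mkAlgHom K (RestrictedSymRel K V p) '' Set.range (TensorAlgebra.ι K (M := V)) := by
    rw [← Set.range_comp]
    rfl
  rw [this, ← AlgHom.map_adjoin, TensorAlgebra.adjoin_range_ι, Algebra.map_top,
    AlgHom.range_eq_top]
  exact RingQuot.mkAlgHom_surjective K _

variable {V}

lemma incl_mul_comm (x y : V) : incl K V p x * incl K V p y = incl K V p y * incl K V p x := by
  have h := RingQuot.mkAlgHom_rel K (RestrictedSymRel.comm (K := K) (p := p) x y)
  rwa [map_mul, map_mul] at h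

lemma incl_pow (x : V) : incl K V p x ^ p = 0 := by
  have h := RingQuot.mkAlgHom_rel K (RestrictedSymRel.pow (K := K) (p := p) x)
  rwa [map_pow, map_zero] at h

variable (V)

/-- The restricted symmetric algebra is commutative. -/
noncomputable abbrev commRing : CommRing (RingQuot (RestrictedSymRel K V p)) :=
  { (inferInstance : Ring (RingQuot (RestrictedSymRel K V p))) with
    mul_comm := fun a b =>
      have hmem : ∀ c, c ∈ Algebra.adjoin K (Set.range (incl K V p)) := fun c => by
        rw [adjoin_range_incl]; trivial
      Algebra.commute_of_mem_adjoin_of_forall_mem_commute (hmem b) fun x hx =>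
        (Algebra.commute_of_mem_adjoin_of_forall_mem_commute (hmem a) fun y hy => by
          obtain ⟨v, rfl⟩ := hx
          obtain ⟨w, rfl⟩ := hy
          exact incl_mul_comm K p v w).symm }

variable {V} in
lemma exists_algHom_dualNumber [Fact p.Prime] (f : V →ₗ[K] K) :
    ∃ φ : RingQuot (RestrictedSymRel K V p) →ₐ[K] DualNumber K,
      ∀ v, φ (incl K V p v) = f v • DualNumber.eps := by
  let F : TensorAlgebra K V →ₐ[K] DualNumber K :=
    TensorAlgebra.lift K (f.smulRight DualNumber.eps)
  have hF : ∀ v, F (TensorAlgebra.ι K v) = f v • DualNumber.eps := fun v => by simp [F]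
  have hrel : ∀ ⦃x y⦄, RestrictedSymRel K V p x y → F x = F y := by
    rintro _ _ (⟨x, y⟩ | ⟨x⟩)
    · rw [map_mul, map_mul, mul_comm]
    · obtain ⟨k, hk⟩ := Nat.exists_eq_add_of_le (Fact.out : p.Prime).two_le
      rw [map_pow, map_zero, hF, smul_pow, hk, pow_add DualNumber.eps, pow_two DualNumber.eps,
        DualNumber.eps_mul_eps, zero_mul, smul_zero]
  refine ⟨RingQuot.liftAlgHom K ⟨F, hrel⟩, fun v => ?_⟩
  rw [← hF]
  exact RingQuot.liftAlgHom_mkAlgHom_apply K F hrel _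

end RestrictedSymRel

/-- in characteristic `p > 0`, with the (unique) comultiplication on
`𝔰(V) = T(V)/(xy - yx, x^p)` making the elements of `V` primitive, the space of primitive
elements of `𝔰(V)` is exactly the image of `V`. -/
theorem stmt14 {K V : Type*} [Field K] [AddCommGroup V] [Module K V]
    (p : ℕ) [Fact p.Prime] [CharP K p]
    (Δ : RingQuot (RestrictedSymRel K V p) →ₐ[K]
      RingQuot (RestrictedSymRel K V p) ⊗[K] RingQuot (RestrictedSymRel K V p))
    (hΔ : ∀ v : V, Δ (RingQuot.mkAlgHom K (RestrictedSymRel K V p) (TensorAlgebra.ι K v)) =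
      RingQuot.mkAlgHom K (RestrictedSymRel K V p) (TensorAlgebra.ι K v) ⊗ₜ 1 +
        1 ⊗ₜ RingQuot.mkAlgHom K (RestrictedSymRel K V p) (TensorAlgebra.ι K v)) :
    ∀ z : RingQuot (RestrictedSymRel K V p),
      (Δ z = z ⊗ₜ 1 + 1 ⊗ₜ z) ↔
        z ∈ LinearMap.range ((RingQuot.mkAlgHom K (RestrictedSymRel K V p)).toLinearMap ∘ₗ
          TensorAlgebra.ι K (M := V)) := by
  let := RestrictedSymRel.commRing K V p
  intro z
  constructor
  · exact mem_range_of_primitive p (RestrictedSymRel.incl K V p)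
      (RestrictedSymRel.adjoin_range_incl K V p) (RestrictedSymRel.incl_pow K p)
      (RestrictedSymRel.exists_algHom_dualNumber K p) Δ hΔ z
  · rintro ⟨v, rfl⟩
    exact hΔ v
end
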